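/- arXiv:2006.05799 — 6 statements merged into one kernel-verified Lean document; each statement's English description precedes it below -/
import Mathlib

section
/- Let F : ℝ → ℝ satisfy (i) F(x·y) = F(x)·F(y) for all real x, y, and (ii) there exist a constant d ∈ (0,1) and a constant ῡ > 0 such that |F(p+1) − 1| ≤ ῡ·|F(p)| + d for all real p. Then for all real x1, x2 there exist real numbers ℓ and υ with 1−d ≤ ℓ ≤ 1+d and |υ| ≤ max(ῡ, 1) such that F(x1 + x2) = ℓ·F(x1) + υ·F(x2). -/
/-- A real number bounded by `c * |t| + d` splits as a part of size at most `d` plus a multiple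
of `t` with coefficient of size at most `c`. -/
theorem exists_add_mul_of_abs_le {e t c d : ℝ} (hc : 0 ≤ c) (hd : 0 ≤ d)
    (h : |e| ≤ c * |t| + d) : ∃ a υ : ℝ, |a| ≤ d ∧ |υ| ≤ c ∧ e = a + υ * t := by
  obtain ⟨a, ha, hea⟩ : ∃ a : ℝ, |a| ≤ d ∧ |e - a| ≤ c * |t| := by
    have hct : 0 ≤ c * |t| := by positivity
    rw [abs_le] at h
    rcases le_total e (-d) with h₁ | h₁
    · exact ⟨-d, by rw [abs_neg, abs_of_nonneg hd], by rw [abs_le]; constructor <;> linarith⟩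
    rcases le_total e d with h₂ | h₂
    · exact ⟨e, abs_le.2 ⟨h₁, h₂⟩, by simpa using hct⟩
    · exact ⟨d, (abs_of_nonneg hd).le, by rw [abs_le]; constructor <;> linarith⟩
  rcases eq_or_ne t 0 with rfl | ht
  · have : e - a = 0 := by simpa using hea
    exact ⟨a, 0, ha, by simpa using hc, by linarith⟩
  · refine ⟨a, (e - a) / t, ha, ?_, by field_simp; ring⟩
    rwa [abs_div, div_le_iff₀ (abs_pos.2 ht)]

theorem stmt_3 (F : ℝ → ℝ) (d υbar : ℝ)
    (hmul : ∀ x y : ℝ, F (x * y) = F x * F y)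
    (hd0 : 0 < d) (hd1 : d < 1) (hυbar : 0 < υbar)
    (hbound : ∀ p : ℝ, |F (p + 1) - 1| ≤ υbar * |F p| + d) :
    ∀ x1 x2 : ℝ, ∃ ℓ υ : ℝ,
      1 - d ≤ ℓ ∧ ℓ ≤ 1 + d ∧ |υ| ≤ max υbar 1 ∧
        F (x1 + x2) = ℓ * F x1 + υ * F x2 := by
  intro x1 x2
  rcases eq_or_ne x1 0 with rfl | hx1
  · rcases eq_or_ne (F 0) 0 with h0 | h0
    · exact ⟨1, 1, by linarith, by linarith, by simp, by simp [h0]⟩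
    · have hx2 : F x2 = 1 := by
        have h := hmul 0 x2
        rw [zero_mul] at h
        exact mul_left_cancel₀ h0 (by rw [← h, mul_one])
      have h00 : F 0 = 1 := by
        have h := hmul 0 0
        rw [zero_mul] at h
        exact mul_left_cancel₀ h0 (by rw [← h, mul_one])
      exact ⟨1, 0, by linarith, by linarith, by simp, by simp [hx2, h00]⟩
  · obtain ⟨a, υ, ha, hυ, h⟩ :=
      exists_add_mul_of_abs_le hυbar.le hd0.le (hbound (x2 / x1))
    rw [abs_le] at ha
    refine ⟨1 + a, υ, by linarith, by linarith, hυ.trans (le_max_left _ _), ?_⟩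
    have hsum : F (x1 + x2) = F x1 * F (x2 / x1 + 1) := by
      rw [← hmul]
      congr 1
      field_simp
      ring
    have hx2 : F x2 = F x1 * F (x2 / x1) := by
      rw [← hmul, mul_div_cancel₀ _ hx1]
    rw [hsum, hx2]
    linear_combination F x1 * h
end

section
/- For every positive odd integer r there exist a constant d ∈ (0,1) and a constant ῡ > 0 such that for all real x1, x2 there exist real numbers ℓ and υ with 1−d ≤ ℓ ≤ 1+d and |υ| ≤ ῡ satisfying (x1 + x2)^r = ℓ·x1^r + υ·x2^r. -/
theorem exists_pos_abs_one_add_pow_sub_one_le (r : ℕ) {d : ℝ} (hd : 0 < d) :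
    ∃ δ > 0, ∀ s : ℝ, |s| ≤ δ → |(1 + s) ^ r - 1| ≤ d := by
  have hcont : Continuous fun s : ℝ => (1 + s) ^ r := by fun_prop
  obtain ⟨δ, hδ, h⟩ := Metric.continuous_iff.1 hcont 0 d hd
  refine ⟨δ / 2, half_pos hδ, fun s hs => ?_⟩
  have := h s (by rw [Real.dist_eq, sub_zero]; linarith)
  simpa [Real.dist_eq] using this.le

theorem exists_separable_pow (r : ℕ) {d : ℝ} (hd : 0 < d) :
    ∃ C : ℝ, 0 < C ∧ ∀ x y : ℝ, ∃ l v : ℝ,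
      1 - d ≤ l ∧ l ≤ 1 + d ∧ |v| ≤ C ∧ (x + y) ^ r = l * x ^ r + v * y ^ r := by
  obtain ⟨δ, hδ, h⟩ := exists_pos_abs_one_add_pow_sub_one_le r hd
  refine ⟨(δ⁻¹ + 1) ^ r + δ⁻¹ ^ r, by positivity, fun x y => ?_⟩
  by_cases hxy : |y| ≤ δ * |x|
  · rcases eq_or_ne x 0 with rfl | hx
    · obtain rfl : y = 0 := by simpa using hxy
      exact ⟨1, 0, by linarith, by linarith, by rw [abs_zero]; positivity, by simp⟩
    · have hl := abs_le.1 (h (y / x) (by rwa [abs_div, div_le_iff₀ (abs_pos.2 hx)]))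
      refine ⟨(1 + y / x) ^ r, 0, by linarith, by linarith, by rw [abs_zero]; positivity, ?_⟩
      rw [← mul_pow, zero_mul, add_zero]
      congr 1
      field_simp
  · push Not at hxy
    have hy : y ≠ 0 := abs_pos.1 (lt_of_le_of_lt (by positivity) hxy)
    have ht : |x / y| ≤ δ⁻¹ := by
      rw [abs_div, div_le_iff₀ (abs_pos.2 hy), le_inv_mul_iff₀ hδ]
      exact hxy.le
    refine ⟨1, (x / y + 1) ^ r - (x / y) ^ r, by linarith, by linarith, ?_, ?_⟩
    · calc |(x / y + 1) ^ r - (x / y) ^ r|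
          ≤ |x / y + 1| ^ r + |x / y| ^ r := by
            simpa only [abs_pow] using abs_sub ((x / y + 1) ^ r) ((x / y) ^ r)
        _ ≤ (δ⁻¹ + 1) ^ r + δ⁻¹ ^ r := by
            have : |x / y + 1| ≤ δ⁻¹ + 1 := by
              simpa using (abs_add_le (x / y) 1).trans (by simpa using ht)
            gcongr
    · rw [sub_mul, ← mul_pow, ← mul_pow, add_mul, div_mul_cancel₀ x hy]
      ring

theorem stmt_4 (r : ℕ) (hr1 : 1 ≤ r) (hodd : Odd r) :
    ∃ d υbar : ℝ, 0 < d ∧ d < 1 ∧ 0 < υbar ∧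
      ∀ x1 x2 : ℝ, ∃ ℓ υ : ℝ,
        1 - d ≤ ℓ ∧ ℓ ≤ 1 + d ∧ |υ| ≤ υbar ∧
          (x1 + x2) ^ r = ℓ * x1 ^ r + υ * x2 ^ r := by
  obtain ⟨C, hC, h⟩ := exists_separable_pow r (one_half_pos (α := ℝ))
  exact ⟨1 / 2, C, one_half_pos, one_half_lt_one, hC, h⟩
end

section
/- For every positive odd integer r and every real d ∈ (0,1), there exists a constant ῡ > 0 such that for all real p, |(p+1)^r − 1| ≤ ῡ·|p|^r + d. -/
/-- Near `p = 0` the left side is less than `d` by continuity; away from `0` it is of order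
`|p| ^ r`. -/
theorem exists_abs_add_one_pow_sub_one_le (r : ℕ) {d : ℝ} (hd : 0 < d) :
    ∃ C : ℝ, 0 < C ∧ ∀ p : ℝ, |(p + 1) ^ r - 1| ≤ C * |p| ^ r + d := by
  have hcont : Continuous fun p : ℝ => (p + 1) ^ r := by fun_prop
  obtain ⟨δ, hδ, hnear⟩ := Metric.continuous_iff.mp hcont 0 d hd
  refine ⟨(1 + δ⁻¹) ^ r + δ⁻¹ ^ r, by positivity, fun p => ?_⟩
  rcases lt_or_ge |p| δ with hp | hp
  · have hlt : |(p + 1) ^ r - 1| < d := by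
      simpa [Real.dist_eq] using hnear p (by simpa [Real.dist_eq] using hp)
    have hnonneg : 0 ≤ ((1 + δ⁻¹) ^ r + δ⁻¹ ^ r) * |p| ^ r := by positivity
    linarith
  · have hone : 1 ≤ δ⁻¹ * |p| := by
      rwa [inv_mul_eq_div, one_le_div hδ]
    have habs : |p + 1| ≤ (1 + δ⁻¹) * |p| := by
      have := abs_add_le p 1
      rw [abs_one] at this
      linarith
    calc |(p + 1) ^ r - 1| ≤ |(p + 1) ^ r| + |1| := abs_sub _ _
      _ = |p + 1| ^ r + 1 := by rw [abs_pow, abs_one]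
      _ ≤ ((1 + δ⁻¹) * |p|) ^ r + (δ⁻¹ * |p|) ^ r :=
        add_le_add (pow_le_pow_left₀ (abs_nonneg _) habs r) (one_le_pow₀ hone)
      _ = ((1 + δ⁻¹) ^ r + δ⁻¹ ^ r) * |p| ^ r := by rw [mul_pow, mul_pow, add_mul]
      _ ≤ ((1 + δ⁻¹) ^ r + δ⁻¹ ^ r) * |p| ^ r + d := le_add_of_nonneg_right hd.le

theorem stmt_5 (r : ℕ) (hr1 : 1 ≤ r) (hodd : Odd r) (d : ℝ) (hd0 : 0 < d) (hd1 : d < 1) :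
    ∃ υbar : ℝ, 0 < υbar ∧ ∀ p : ℝ, |(p + 1) ^ r - 1| ≤ υbar * |p| ^ r + d := by
  exact exists_abs_add_one_pow_sub_one_le r hd0
end

section
/- For every positive odd integer r there exist a constant d ∈ (0,1) and a constant ῡ > 0 such that for every positive integer a and all real numbers s, w, v, there exists a real number ℓ with 1−d ≤ ℓ ≤ 1+d satisfying s^a · (w + v)^r ≤ ῡ · |s|^a · |w|^r + ℓ · s^a · v^r. -/
/-- Perturbing the base of a power: the change is controlled by the perturbation,
up to an arbitrarily small multiple of the original power. -/
theorem exists_abs_add_pow_sub_pow_le (r : ℕ) {ε : ℝ} (hε : 0 < ε) :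
    ∃ C : ℝ, 0 < C ∧ ∀ w v : ℝ, |(w + v) ^ r - v ^ r| ≤ C * |w| ^ r + ε * |v| ^ r := by
  have hcont : Continuous fun x : ℝ => (x + 1) ^ r := by fun_prop
  obtain ⟨δ, hδ, h⟩ := Metric.continuous_iff.1 hcont 0 ε hε
  simp only [Real.dist_eq, sub_zero, zero_add, one_pow] at h
  refine ⟨(1 + 1 / δ) ^ r + (1 / δ) ^ r, by positivity, fun w v => ?_⟩
  rcases lt_or_ge |w| (δ * |v|) with hwv | hwv
  · have hv : v ≠ 0 := by
      rintro rfl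
      simp only [abs_zero, mul_zero] at hwv
      exact (abs_nonneg w).not_gt hwv
    have hx : |w / v| < δ := by
      rwa [abs_div, div_lt_iff₀ (abs_pos.2 hv)]
    have hfactor : (w + v) ^ r - v ^ r = ((w / v + 1) ^ r - 1) * v ^ r := by
      rw [sub_mul, ← mul_pow, one_mul, add_mul, div_mul_cancel₀ _ hv, one_mul]
    rw [hfactor, abs_mul, abs_pow v]
    have hsmall := mul_le_mul_of_nonneg_right (h _ hx).le (pow_nonneg (abs_nonneg v) r)
    have hC : 0 ≤ ((1 + 1 / δ) ^ r + (1 / δ) ^ r) * |w| ^ r := by positivity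
    linarith
  · have hv : |v| ≤ 1 / δ * |w| := by
      rw [one_div_mul_eq_div, le_div_iff₀ hδ]
      linarith
    have hsum : |w + v| ≤ (1 + 1 / δ) * |w| := by
      linarith [abs_add_le w v]
    have hv_pow := pow_le_pow_left₀ (abs_nonneg v) hv r
    have hsum_pow := pow_le_pow_left₀ (abs_nonneg (w + v)) hsum r
    have htri := abs_sub ((w + v) ^ r) (v ^ r)
    rw [mul_pow] at hv_pow hsum_pow
    rw [abs_pow, abs_pow] at htri
    have hεv : 0 ≤ ε * |v| ^ r := by positivity
    linarith

theorem stmt_7 (r : ℕ) (hr1 : 1 ≤ r) (hodd : Odd r) :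
    ∃ d υbar : ℝ, 0 < d ∧ d < 1 ∧ 0 < υbar ∧
      ∀ a : ℕ, 0 < a → ∀ s w v : ℝ, ∃ ℓ : ℝ,
        1 - d ≤ ℓ ∧ ℓ ≤ 1 + d ∧
          s ^ a * (w + v) ^ r ≤ υbar * |s| ^ a * |w| ^ r + ℓ * s ^ a * v ^ r := by
  obtain ⟨C, hC, h⟩ := exists_abs_add_pow_sub_pow_le r (ε := 1 / 2) (by norm_num)
  refine ⟨1 / 2, C, by norm_num, by norm_num, hC, fun a _ s w v => ?_⟩
  have hdiff : s ^ a * ((w + v) ^ r - v ^ r) ≤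
      C * |s| ^ a * |w| ^ r + 1 / 2 * |s ^ a * v ^ r| := by
    calc s ^ a * ((w + v) ^ r - v ^ r) ≤ |s| ^ a * |(w + v) ^ r - v ^ r| := by
          rw [← abs_pow, ← abs_mul]
          exact le_abs_self _
      _ ≤ |s| ^ a * (C * |w| ^ r + 1 / 2 * |v| ^ r) := by
          gcongr
          exact h w v
      _ = C * |s| ^ a * |w| ^ r + 1 / 2 * |s ^ a * v ^ r| := by
          rw [abs_mul, abs_pow, abs_pow]
          ring
  rcases le_total 0 (s ^ a * v ^ r) with hsv | hsv
  · rw [abs_of_nonneg hsv] at hdiff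
    exact ⟨3 / 2, by norm_num, by norm_num, by linarith⟩
  · rw [abs_of_nonpos hsv] at hdiff
    exact ⟨1 / 2, by norm_num, by norm_num, by linarith⟩
end

section
/- Let r and r1 be positive odd integers with r1 ≤ r, and set r̄ = (r+1)/(r−r1+1) and r̲ = (r+1)/r1. Then for all reals ζ > 0, b > 0, W ≥ 0, Θ ≥ 0, ε ≥ 0 and every real s, the inequality |s|^{r−r1+1} · (W·Θ + ε) ≤ s^{r+1} · (b^{r̄} + ζ^{r̄} · (W·Θ)^{r̄}) + ζ^{−r̲} + b^{−r̲} · ε^{r̲} holds. -/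
theorem Real.mul_le_weighted_rpow_add_rpow {p q c x y : ℝ} (hpq : p.HolderConjugate q)
    (hc : 0 < c) (hx : 0 ≤ x) (hy : 0 ≤ y) :
    x * y ≤ c ^ p * x ^ p + c ^ (-q) * y ^ q := by
  have hcx : 0 ≤ c * x := by positivity
  have hcy : 0 ≤ c⁻¹ * y := by positivity
  calc x * y = (c * x) * (c⁻¹ * y) := by field_simp
    _ ≤ (c * x) ^ p / p + (c⁻¹ * y) ^ q / q := Real.young_inequality_of_nonneg hcx hcy hpq
    _ ≤ (c * x) ^ p + (c⁻¹ * y) ^ q :=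
      add_le_add (div_le_self (Real.rpow_nonneg hcx p) hpq.lt.le)
        (div_le_self (Real.rpow_nonneg hcy q) hpq.symm.lt.le)
    _ = c ^ p * x ^ p + c ^ (-q) * y ^ q := by
      rw [Real.mul_rpow hc.le hx, Real.mul_rpow (inv_nonneg.2 hc.le) hy,
        Real.inv_rpow hc.le, Real.rpow_neg hc.le]

theorem stmt_9 (r r1 : ℕ) (hr : Odd r) (hr1 : Odd r1) (hr1pos : 1 ≤ r1) (hle : r1 ≤ r)
    (ζ b W Θ ε : ℝ) (hζ : 0 < ζ) (hb : 0 < b) (hW : 0 ≤ W) (hΘ : 0 ≤ Θ) (hε : 0 ≤ ε)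
    (s : ℝ) :
    |s| ^ (r - r1 + 1) * (W * Θ + ε) ≤
      s ^ (r + 1) * (b ^ (((r : ℝ) + 1) / ((r : ℝ) - (r1 : ℝ) + 1)) +
          ζ ^ (((r : ℝ) + 1) / ((r : ℝ) - (r1 : ℝ) + 1)) *
            (W * Θ) ^ (((r : ℝ) + 1) / ((r : ℝ) - (r1 : ℝ) + 1))) +
        ζ ^ (-(((r : ℝ) + 1) / (r1 : ℝ))) + b ^ (-(((r : ℝ) + 1) / (r1 : ℝ))) * ε ^ (((r : ℝ) + 1) / (r1 : ℝ)) := by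
  have hr1' : (1 : ℝ) ≤ r1 := by exact_mod_cast hr1pos
  have hle' : (r1 : ℝ) ≤ r := by exact_mod_cast hle
  have hd : (0 : ℝ) < (r : ℝ) - r1 + 1 := by linarith
  have hpq : (((r : ℝ) + 1) / ((r : ℝ) - (r1 : ℝ) + 1)).HolderConjugate
      (((r : ℝ) + 1) / (r1 : ℝ)) := by
    rw [Real.holderConjugate_iff]
    refine ⟨(one_lt_div hd).2 (by linarith), ?_⟩
    rw [inv_div, inv_div, ← add_div, div_eq_one_iff_eq (by linarith)]
    ring
  have hpow : (|s| ^ (r - r1 + 1)) ^ (((r : ℝ) + 1) / ((r : ℝ) - (r1 : ℝ) + 1)) =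
      s ^ (r + 1) := by
    rw [← hr.add_one.pow_abs s, ← Real.rpow_natCast, ← Real.rpow_natCast,
      ← Real.rpow_mul (abs_nonneg s)]
    congr 1
    push_cast [Nat.cast_sub hle]
    field_simp
  have hs : 0 ≤ |s| ^ (r - r1 + 1) := by positivity
  have hWΘ : 0 ≤ W * Θ := mul_nonneg hW hΘ
  have h₁ := Real.mul_le_weighted_rpow_add_rpow hpq hζ (mul_nonneg hs hWΘ) zero_le_one
  have h₂ := Real.mul_le_weighted_rpow_add_rpow hpq hb hs hε
  rw [Real.mul_rpow hs hWΘ, hpow, Real.one_rpow] at h₁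
  rw [hpow] at h₂
  linarith
end

section
/- Let r and r1 be positive odd integers with r1 ≤ r, and let γ > 0 be a real number. Then for every real s, the inequality γ^{(r1−1)/(r+1)} · s^{r−r1+2} ≤ γ + s^{r+1} holds. -/
theorem stmt_10 (r r1 : ℕ) (hr : Odd r) (hr1 : Odd r1) (hr1pos : 1 ≤ r1) (hle : r1 ≤ r)
    (γ : ℝ) (hγ : 0 < γ) (s : ℝ) :
    γ ^ (((r1 : ℝ) - 1) / ((r : ℝ) + 1)) * s ^ (r - r1 + 2) ≤ γ + s ^ (r + 1) := by
  have h_even : Even (r - r1 + 2) := (Nat.Odd.sub_odd hr hr1).add even_two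
  rw [← h_even.pow_abs, ← hr.add_one.pow_abs]
  have h_r1 : (1 : ℝ) ≤ r1 := by exact_mod_cast hr1pos
  have h_r : (r1 : ℝ) ≤ r := by exact_mod_cast hle
  have h_pos : (0 : ℝ) < (r : ℝ) + 1 := by positivity
  have hw₁ : 0 ≤ ((r1 : ℝ) - 1) / ((r : ℝ) + 1) := div_nonneg (by linarith) h_pos.le
  have hw₂ : 0 ≤ ((r : ℝ) - r1 + 2) / ((r : ℝ) + 1) := div_nonneg (by linarith) h_pos.le
  have hw : ((r1 : ℝ) - 1) / ((r : ℝ) + 1) + ((r : ℝ) - r1 + 2) / ((r : ℝ) + 1) = 1 := by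
    field_simp
    ring
  have hs : 0 ≤ |s| ^ (r + 1) := by positivity
  have h_pow : (|s| ^ (r + 1)) ^ (((r : ℝ) - r1 + 2) / ((r : ℝ) + 1)) = |s| ^ (r - r1 + 2) := by
    rw [← Real.rpow_natCast, ← Real.rpow_natCast, ← Real.rpow_mul (abs_nonneg s)]
    congr 1
    push_cast [Nat.cast_sub hle]
    field_simp
  have h_amgm := Real.geom_mean_le_arith_mean2_weighted hw₁ hw₂ hγ.le hs hw
  rw [h_pow] at h_amgm
  refine h_amgm.trans (add_le_add ?_ ?_)
  · exact mul_le_of_le_one_left hγ.le (by linarith)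
  · exact mul_le_of_le_one_left hs (by linarith)
end
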